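/- Suppose all decision-makers share the same constraints: A^k = A and b^k = b for every k ∈ {1,…,K}, where A is a real m × n matrix with rows a^1,…,a^m and X = {x ∈ ℝⁿ : A x ≥ b} is nonempty and bounded. If the infimum ρ* defining the stability-driven clustering value is attained, then it is attained by a cluster assignment g̃ : {1,…,K} → {1,…,L} and cost vectors c̃^1,…,c̃^L ∈ ℝⁿ with ‖c̃^ℓ‖₁ = 1 such that for every cluster ℓ ∈ {1,…,L} there exists an index set I^{ℓ*} ⊆ {1,…,m} with |I^{ℓ*}| = n and c̃^ℓ ∈ cone₊({a^i : i ∈ I^{ℓ*}}), i.e. c̃^ℓ = Σ_{i∈I^{ℓ*}} λ_i a^i with λ_i > 0 for every i ∈ I^{ℓ*} (the interior of the conic hull of the selected rows). -/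

import Mathlib

/- Corollary 1 of the paper (the special case where all DMPs are identical). -/

open scoped Matrix BigOperators

/-- Feasible set `{x : A x ≥ b}` of a linear program given by the rows `a i` of `A`. -/
def Feas {n m : ℕ} (a : Fin m → Fin n → ℝ) (b : Fin m → ℝ) : Set (Fin n → ℝ) :=
  {x | ∀ i, b i ≤ a i ⬝ᵥ x}

/-- Optimal-solution set `X*(c) = argmin {c·x : A x ≥ b}`. -/
def OptSet {n m : ℕ} (a : Fin m → Fin n → ℝ) (b : Fin m → ℝ) (c : Fin n → ℝ) :
    Set (Fin n → ℝ) :=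
  {x ∈ Feas a b | ∀ y ∈ Feas a b, c ⬝ᵥ x ≤ c ⬝ᵥ y}

/-- Worst-case distance `W(g,c)` when all decision-makers share the same constraints `(A, b)`. -/
noncomputable def WDist {n m : ℕ} (K L : ℕ) (N : Seminorm ℝ (Fin n → ℝ))
    (a : Fin m → Fin n → ℝ) (b : Fin m → ℝ)
    (xhat : Fin K → Fin n → ℝ) (g : Fin K → Fin L) (c : Fin L → Fin n → ℝ) : ℝ :=
  ⨆ k : Fin K, sSup ((fun x => N (xhat k - x)) '' OptSet a b (c (g k)))

/-- The stability-driven clustering (SC) optimal value `ρ*` (identical DMPs). -/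
noncomputable def SCval {n m : ℕ} (K L : ℕ) (N : Seminorm ℝ (Fin n → ℝ))
    (a : Fin m → Fin n → ℝ) (b : Fin m → ℝ) (xhat : Fin K → Fin n → ℝ) : ℝ :=
  sInf {r : ℝ | ∃ (g : Fin K → Fin L) (c : Fin L → Fin n → ℝ),
    (∀ ℓ, ∑ j, |c ℓ j| = 1) ∧ r = WDist K L N a b xhat g c}

lemma feas_isClosed {n m : ℕ} (a : Fin m → Fin n → ℝ) (b : Fin m → ℝ) : IsClosed (Feas a b) := by
  have : Feas a b = ⋂ i, {x | b i ≤ a i ⬝ᵥ x} := by ext x; simp [Feas]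
  rw [this]
  refine isClosed_iInter fun i => isClosed_le continuous_const ?_
  exact continuous_const.dotProduct continuous_id

lemma optSet_isCompact {n m : ℕ} (a : Fin m → Fin n → ℝ) (b : Fin m → ℝ)
    (hbdd : Bornology.IsBounded (Feas a b)) (c : Fin n → ℝ) : IsCompact (OptSet a b c) := by
  refine Metric.isCompact_of_isClosed_isBounded ?_ (hbdd.subset fun x hx => hx.1)
  have : OptSet a b c = Feas a b ∩ ⋂ y ∈ Feas a b, {x | c ⬝ᵥ x ≤ c ⬝ᵥ y} := by
    ext x; simp [OptSet]
  rw [this]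
  refine (feas_isClosed a b).inter (isClosed_biInter fun y _ => isClosed_le ?_ continuous_const)
  exact continuous_const.dotProduct continuous_id

lemma optSet_nonempty {n m : ℕ} (a : Fin m → Fin n → ℝ) (b : Fin m → ℝ)
    (hne : (Feas a b).Nonempty)
    (hbdd : Bornology.IsBounded (Feas a b)) (c : Fin n → ℝ) : (OptSet a b c).Nonempty := by
  have hc : IsCompact (Feas a b) :=
    Metric.isCompact_of_isClosed_isBounded (feas_isClosed a b) hbdd
  obtain ⟨x, hx, hmin⟩ := hc.exists_isMinOn hne
    (f := fun x => c ⬝ᵥ x) (continuous_const.dotProduct continuous_id).continuousOn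
  exact ⟨x, hx, fun y hy => hmin hy⟩

lemma span_active {n m : ℕ} (a : Fin m → Fin n → ℝ) (b : Fin m → ℝ) (c v : Fin n → ℝ)
    (hv : v ∈ (OptSet a b c).extremePoints ℝ) :
    Submodule.span ℝ (a '' {i | a i ⬝ᵥ v = b i}) = ⊤ := by
  by_contra hne
  obtain ⟨f, hf0, hf⟩ := Submodule.exists_le_ker_of_lt_top _ (lt_top_iff_ne_top.2 hne)
  obtain ⟨d, rfl⟩ := (dotProductEquiv ℝ (Fin n)).surjective f
  have hd0 : d ≠ 0 := by
    rintro rfl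
    simp at hf0
  have hact : ∀ i, a i ⬝ᵥ v = b i → a i ⬝ᵥ d = 0 := by
    intro i hi
    have h1 := hf (Submodule.subset_span ⟨i, hi, rfl⟩)
    rw [LinearMap.mem_ker, dotProductEquiv_apply_apply] at h1
    rw [dotProduct_comm]; exact h1
  have hev : ∀ᶠ e : ℝ in nhds 0, ∀ i, b i ≤ a i ⬝ᵥ (v + e • d) := by
    rw [Filter.eventually_all]
    intro i
    by_cases hi : a i ⬝ᵥ v = b i
    · refine Filter.Eventually.of_forall fun e => ?_
      rw [dotProduct_add, dotProduct_smul, hact i hi, hi]; simp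
    · have hlt : b i < a i ⬝ᵥ v := lt_of_le_of_ne (hv.1.1 i) (Ne.symm hi)
      have hcont : Continuous fun e : ℝ => a i ⬝ᵥ (v + e • d) := by
        simp only [dotProduct_add, dotProduct_smul]
        fun_prop
      have := hcont.tendsto 0
      simp only [zero_smul, add_zero] at this
      exact (this.eventually (lt_mem_nhds hlt)).mono fun e he => le_of_lt he
  obtain ⟨δ, hδ, hball⟩ := Metric.eventually_nhds_iff.1 hev
  have hp : v + (δ / 2) • d ∈ Feas a b := hball (by
    rw [Real.dist_eq, sub_zero, abs_of_pos (by linarith)]; linarith)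
  have hm : v + (-(δ / 2)) • d ∈ Feas a b := hball (by
    rw [Real.dist_eq, sub_zero, abs_neg, abs_of_pos (by linarith)]; linarith)
  have h1 := hv.1.2 _ hp
  have h2 := hv.1.2 _ hm
  simp only [dotProduct_add, dotProduct_smul, smul_eq_mul] at h1 h2
  have h3 : δ / 2 * (c ⬝ᵥ d) = 0 := by linarith
  have hp' : v + (δ / 2) • d ∈ OptSet a b c := ⟨hp, fun y hy => by
    have := hv.1.2 y hy
    simp only [dotProduct_add, dotProduct_smul, smul_eq_mul]; linarith⟩
  have hm' : v + (-(δ / 2)) • d ∈ OptSet a b c := ⟨hm, fun y hy => by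
    have := hv.1.2 y hy
    simp only [dotProduct_add, dotProduct_smul, smul_eq_mul]; linarith⟩
  have hseg : v ∈ openSegment ℝ (v + (δ / 2) • d) (v + (-(δ / 2)) • d) := by
    refine ⟨1 / 2, 1 / 2, by norm_num, by norm_num, by norm_num, ?_⟩
    ext j; simp; ring
  have h4 := hv.2 hp' hm' hseg
  have h5 : (δ / 2) • d = 0 := by simpa using h4
  rcases smul_eq_zero.1 h5 with h | h
  · linarith
  · exact hd0 h

lemma key {n m : ℕ} (hn : 1 ≤ n) (a : Fin m → Fin n → ℝ) (b : Fin m → ℝ)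
    (hne : (Feas a b).Nonempty)
    (hbdd : Bornology.IsBounded (Feas a b)) (c : Fin n → ℝ) :
    ∃ c' : Fin n → ℝ, ∑ j, |c' j| = 1 ∧ OptSet a b c' ⊆ OptSet a b c ∧
      ∃ I : Finset (Fin m), I.card = n ∧
        ∃ lam : Fin m → ℝ, (∀ i ∈ I, 0 < lam i) ∧ c' = ∑ i ∈ I, lam i • a i := by
  obtain ⟨v, hv⟩ := (optSet_isCompact a b hbdd c).extremePoints_nonempty
    (optSet_nonempty a b hne hbdd c)
  have hspan := span_active a b c v hv
  obtain ⟨t, hts, htc, htspan, htli⟩ :=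
    Submodule.exists_finset_span_eq_linearIndepOn ℝ (a '' {i | a i ⬝ᵥ v = b i})
  rw [hspan] at htc htspan
  have htc' : t.card = n := by simpa using htc
  have htne : t.Nonempty := by
    rw [← Finset.card_pos]; omega
  have : Nonempty (Fin m) := by
    obtain ⟨u, hu⟩ := htne
    obtain ⟨i, -⟩ := hts hu
    exact ⟨i⟩
  have hts' : ∀ u : Fin n → ℝ, u ∈ t → ∃ i, a i ⬝ᵥ v = b i ∧ a i = u := fun u hu => hts hu
  choose! f hf using hts'
  have hinj : Set.InjOn f (t : Set (Fin n → ℝ)) := by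
    intro x hx y hy hxy
    rw [← (hf x hx).2, ← (hf y hy).2, hxy]
  have hsum : ∑ u ∈ t, u ≠ 0 := by
    intro h0
    obtain ⟨u, hu⟩ := htne
    have := linearIndepOn_finset_iff.1 htli (fun _ => 1) (by simpa using h0) u hu
    exact one_ne_zero this
  set w := ∑ u ∈ t, u with hw
  have hs : 0 < ∑ j, |w j| := by
    obtain ⟨j, hj⟩ := Function.ne_iff.1 hsum
    exact Finset.sum_pos' (fun _ _ => abs_nonneg _) ⟨j, Finset.mem_univ _, abs_pos.2 hj⟩
  set s := ∑ j, |w j| with hsdef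
  refine ⟨s⁻¹ • w, ?_, ?_, t.image f, ?_, fun _ => s⁻¹, fun _ _ => inv_pos.2 hs, ?_⟩
  · simp only [Pi.smul_apply, smul_eq_mul, abs_mul, ← Finset.mul_sum, abs_of_pos (inv_pos.2 hs)]
    exact inv_mul_cancel₀ hs.ne'
  · intro y hy
    have hle := hy.2 v hv.1.1
    simp only [smul_dotProduct, smul_eq_mul] at hle
    have hle2 : w ⬝ᵥ y ≤ w ⬝ᵥ v := le_of_mul_le_mul_left hle (inv_pos.2 hs)
    rw [hw, sum_dotProduct, sum_dotProduct] at hle2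
    have hge : ∀ u ∈ t, u ⬝ᵥ v ≤ u ⬝ᵥ y := by
      intro u hu
      have h1 := (hf u hu).1
      have h2 := hy.1 (f u)
      simp only [(hf u hu).2] at h1 h2
      rw [h1]; exact h2
    have heq := (Finset.sum_eq_sum_iff_of_le hge).1
      (le_antisymm (Finset.sum_le_sum hge) hle2)
    have hker : Submodule.span ℝ (t : Set (Fin n → ℝ)) ≤
        LinearMap.ker (dotProductEquiv ℝ (Fin n) (y - v)) := by
      rw [Submodule.span_le]
      intro u hu
      have := heq u hu
      simp only [SetLike.mem_coe, LinearMap.mem_ker, dotProductEquiv_apply_apply]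
      rw [dotProduct_comm, dotProduct_sub]; linarith
    rw [htspan, top_le_iff, LinearMap.ker_eq_top] at hker
    have hyv : y - v = 0 := (LinearEquiv.map_eq_zero_iff _).1 hker
    rw [sub_eq_zero.1 hyv]; exact hv.1
  · rw [Finset.card_image_of_injOn hinj, htc']
  · rw [Finset.sum_image hinj, hw, Finset.smul_sum]
    exact Finset.sum_congr rfl fun u hu => by rw [(hf u hu).2]

/-- **Corollary 1.** If all DMs share the same constraints `A x ≥ b` (with `X` nonempty and
bounded) and the SC value `ρ*` is attained, then it is attained by a cluster assignment `g̃` and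
`ℓ1`-normalized cost vectors `c̃` such that every `c̃^ℓ` lies in the strict conic hull
`cone₊({a^i : i ∈ I^{ℓ*}})` of `n` selected rows of `A`. -/
theorem sc_solution_structure_same_constraints
    (n K L m : ℕ) (hn : 1 ≤ n) (hK : 1 ≤ K) (hL : 1 ≤ L)
    (N : Seminorm ℝ (Fin n → ℝ)) (hN : ∀ x, N x = 0 → x = 0)
    (a : Fin m → Fin n → ℝ) (b : Fin m → ℝ)
    (hne : (Feas a b).Nonempty)
    (hbdd : Bornology.IsBounded (Feas a b))
    (xhat : Fin K → Fin n → ℝ)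
    (hattained : ∃ (g : Fin K → Fin L) (c : Fin L → Fin n → ℝ),
      (∀ ℓ, ∑ j, |c ℓ j| = 1) ∧ WDist K L N a b xhat g c = SCval K L N a b xhat) :
    ∃ (gt : Fin K → Fin L) (ct : Fin L → Fin n → ℝ),
      (∀ ℓ, ∑ j, |ct ℓ j| = 1) ∧
      WDist K L N a b xhat gt ct = SCval K L N a b xhat ∧
      ∀ ℓ : Fin L, ∃ I : Finset (Fin m), I.card = n ∧
        ∃ lam : Fin m → ℝ, (∀ i ∈ I, 0 < lam i) ∧ ct ℓ = ∑ i ∈ I, lam i • a i := by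
  obtain ⟨g, c, hc, hW⟩ := hattained
  choose ct h1 hsub hI using fun ℓ => key hn a b hne hbdd (c ℓ)
  refine ⟨g, ct, h1, le_antisymm ?_ ?_, hI⟩
  · rw [← hW]
    refine ciSup_mono (Set.finite_range _).bddAbove fun k => ?_
    have hcont : Continuous fun x => N (xhat k - x) :=
      (continuousOn_univ.1 (N.convexOn.continuousOn isOpen_univ)).comp
        (continuous_const.sub continuous_id)
    exact csSup_le_csSup ((optSet_isCompact a b hbdd _).image hcont).bddAbove
      ((optSet_nonempty a b hne hbdd _).image _) (Set.image_mono (hsub _))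
  · refine csInf_le ⟨0, ?_⟩ ⟨g, ct, h1, rfl⟩
    rintro r ⟨g', c', -, rfl⟩
    refine Real.iSup_nonneg fun k => Real.sSup_nonneg ?_
    rintro _ ⟨x, -, rfl⟩
    exact apply_nonneg N _
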